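/- Theorem 5 (triple bounded identity): for integers i, j, k, L1, L2, M, define g_{i,j,k}(L1,L2,M) as the sum over nonnegative integers a, b, c, ab, ac, bc with i = a+ab+ac, j = b+ab+bc, k = c+ac+bc, of q^{T_t + T_{ab} + T_{ac} + T_{bc-1}} times { q^{bc} C(L1-t+a, a) C(L2-t+b, b) C(L2-t, ab) C(M-t+c, c) C(M-t, ac) C(M-t, bc) + C(L1-t+a-1, a-1) C(L2-t+b, b) C(L2-t, ab) C(M-t+c, c) C(M-t, ac) C(M-t, bc-1) }, and define p_{i,j,k}(L1,L2,M) = ∑_{s≥0} q^{s(M+2) - T_s + T_{i-s} + T_{j-s} + T_{k-s}} C(L1-s, i-s) C(L2-i, j-s) C(L2-i-j+s, s) C(M-i-j, k-s). Then g_{i,j,k}(L1,L2,M) = p_{i,j,k}(L1,L2,M). -/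

import Mathlib

/- Theorem 5 (triple bounded identity) of Berkovich–Riese.  We work in the field
of rational functions `RatFunc ℚ` with `q = RatFunc.X`.  `T m = m(m+1)/2` is the
triangular number (note `T (-1) = 0`), and `qbin N n` is the Gaussian binomial
coefficient `C(N, n) = (q^{N-n+1};q)_n / (q;q)_n` for `n ≥ 0`, and `0` for `n < 0`. -/

open Finset

noncomputable def q : RatFunc ℚ := RatFunc.X

def T (m : ℤ) : ℤ := m * (m + 1) / 2

noncomputable def qbin (N n : ℤ) : RatFunc ℚ :=
  if n < 0 then 0
  else ∏ r ∈ Finset.range n.toNat, (1 - q ^ (N - (r : ℤ))) / (1 - q ^ ((r : ℤ) + 1))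

/-- The triple-bounded six-fold sum `g_{i,j,k}(L1,L2,M)`: the sum over nonnegative
integers `a, b, c, ab, ac, bc` with `i = a+ab+ac`, `j = b+ab+bc`, `k = c+ac+bc`
(the summation variables below are `ab, ac, bc`, with `a, b, c` determined). -/
noncomputable def g (i j k L1 L2 M : ℤ) : RatFunc ℚ :=
  ∑ ab ∈ Finset.range (i.toNat + 1), ∑ ac ∈ Finset.range (i.toNat + 1),
    ∑ bc ∈ Finset.range (j.toNat + 1),
      if (ab : ℤ) + ac ≤ i ∧ (ab : ℤ) + bc ≤ j ∧ (ac : ℤ) + bc ≤ k then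
        (let a : ℤ := i - ab - ac
         let b : ℤ := j - ab - bc
         let c : ℤ := k - ac - bc
         let t : ℤ := a + b + c + ab + ac + bc
         q ^ (T t + T ab + T ac + T ((bc : ℤ) - 1)) *
           (q ^ (bc : ℤ) * qbin (L1 - t + a) a * qbin (L2 - t + b) b * qbin (L2 - t) ab *
               qbin (M - t + c) c * qbin (M - t) ac * qbin (M - t) bc +
             qbin (L1 - t + a - 1) (a - 1) * qbin (L2 - t + b) b * qbin (L2 - t) ab *
               qbin (M - t + c) c * qbin (M - t) ac * qbin (M - t) ((bc : ℤ) - 1)))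
      else 0

/-- The single sum `p_{i,j,k}(L1,L2,M)`; all terms with `s > i` vanish since
`qbin (L1 - s) (i - s) = 0` for `i - s < 0`, so the range below captures the
full sum over `s ≥ 0`. -/
noncomputable def p (i j k L1 L2 M : ℤ) : RatFunc ℚ :=
  ∑ s ∈ Finset.range (i.toNat + 1),
    q ^ ((s : ℤ) * (M + 2) - T s + T (i - s) + T (j - s) + T (k - s)) *
      qbin (L1 - s) (i - s) * qbin (L2 - i) (j - s) * qbin (L2 - i - j + s) s *
      qbin (M - i - j) (k - s)

lemma q_ne : q ≠ 0 := RatFunc.X_ne_zero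

lemma q_pow_ne (n : ℤ) (hn : 0 < n) : (1 : RatFunc ℚ) - q ^ n ≠ 0 := by
  obtain ⟨m, rfl⟩ := Int.eq_ofNat_of_zero_le hn.le
  have hm : 0 < m := by simpa using hn
  intro h
  have h1 : q ^ m = 1 := by
    have := (sub_eq_zero.mp h).symm
    simpa using this
  have h2 : algebraMap (Polynomial ℚ) (RatFunc ℚ) (Polynomial.X ^ m) =
      algebraMap (Polynomial ℚ) (RatFunc ℚ) 1 := by
    rw [map_pow, RatFunc.algebraMap_X, map_one]
    exact h1
  have h3 := RatFunc.algebraMap_injective ℚ h2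
  have h4 := congrArg Polynomial.natDegree h3
  rw [Polynomial.natDegree_X_pow, Polynomial.natDegree_one] at h4
  omega

lemma T_step (m : ℤ) : T m = T (m - 1) + m := by
  unfold T
  have : m * (m + 1) = (m - 1) * (m - 1 + 1) + m * 2 := by ring
  rw [this, Int.add_mul_ediv_right _ _ (by norm_num)]

lemma qbin_neg (N n : ℤ) (h : n < 0) : qbin N n = 0 := by simp [qbin, h]

lemma qbin_zero (N : ℤ) : qbin N 0 = 1 := by simp [qbin]

lemma qbin_succ (N n : ℤ) (h : 0 ≤ n) :
    qbin N (n + 1) * (1 - q ^ (n + 1)) = qbin N n * (1 - q ^ (N - n)) := by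
  have hne := q_pow_ne (n + 1) (by omega)
  obtain ⟨m, rfl⟩ := Int.eq_ofNat_of_zero_le h
  have e1 : ((m : ℤ) + 1).toNat = m + 1 := by omega
  rw [qbin, qbin, if_neg (by omega), if_neg (by omega), e1, Int.toNat_natCast,
    Finset.prod_range_succ]
  field_simp

lemma qbin_absorb (N n : ℤ) (h : 0 ≤ n) :
    qbin N (n + 1) * (1 - q ^ (n + 1)) = (1 - q ^ N) * qbin (N - 1) n := by
  obtain ⟨m, rfl⟩ := Int.eq_ofNat_of_zero_le h
  clear h
  induction m with
  | zero =>
    have := qbin_succ N 0 le_rfl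
    simp only [qbin_zero] at this
    simp only [Nat.cast_zero, qbin_zero]
    rw [this]; simp
  | succ m ih =>
    have h1 := qbin_succ N ((m : ℤ) + 1) (by omega)
    have h2 := qbin_succ (N - 1) (m : ℤ) (by omega)
    have e : N - 1 - (m : ℤ) = N - (m + 1) := by ring
    rw [e] at h2
    have hne := q_pow_ne ((m : ℤ) + 1) (by omega)
    push_cast
    rw [h1]
    apply mul_right_cancel₀ hne
    linear_combination (1 - q ^ (N - (↑m + 1))) * ih - (1 - q ^ N) * h2

lemma pascal1 (N n : ℤ) : qbin N n = qbin (N - 1) n + q ^ (N - n) * qbin (N - 1) (n - 1) := by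
  rcases lt_trichotomy n 0 with h | h | h
  · rw [qbin_neg _ _ h, qbin_neg _ _ h, qbin_neg _ (n - 1) (by omega)]; simp
  · subst h; rw [qbin_zero, qbin_zero, qbin_neg _ (0 - 1) (by omega)]; simp
  · obtain ⟨m, rfl⟩ : ∃ m, n = m + 1 := ⟨n - 1, by ring⟩
    have h1 := qbin_absorb N m (by omega)
    have h2 := qbin_succ (N - 1) m (by omega)
    have hne := q_pow_ne (m + 1) h
    have e : N - 1 - m = N - (m + 1) := by ring
    have e2 : q ^ N = q ^ (N - (m + 1)) * q ^ (m + 1) := by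
      rw [← zpow_add₀ q_ne]; congr 1; ring
    rw [e] at h2
    rw [e2] at h1
    rw [add_sub_cancel_right]
    apply mul_right_cancel₀ hne
    linear_combination h1 - h2

lemma pascal2 (N n : ℤ) : qbin N n = q ^ n * qbin (N - 1) n + qbin (N - 1) (n - 1) := by
  rcases lt_trichotomy n 0 with h | h | h
  · rw [qbin_neg _ _ h, qbin_neg _ _ h, qbin_neg _ (n - 1) (by omega)]; simp
  · subst h; rw [qbin_zero, qbin_zero, qbin_neg _ (0 - 1) (by omega)]; simp
  · obtain ⟨m, rfl⟩ : ∃ m, n = m + 1 := ⟨n - 1, by ring⟩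
    have h1 := qbin_absorb N m (by omega)
    have h2 := qbin_succ (N - 1) m (by omega)
    have hne := q_pow_ne (m + 1) h
    have e : N - 1 - m = N - (m + 1) := by ring
    have e2 : q ^ N = q ^ (N - (m + 1)) * q ^ (m + 1) := by
      rw [← zpow_add₀ q_ne]; congr 1; ring
    rw [e] at h2
    rw [e2] at h1
    rw [add_sub_cancel_right]
    apply mul_right_cancel₀ hne
    linear_combination h1 - q ^ (m + 1) * h2

lemma qbin_van (N n : ℤ) (h0 : 0 ≤ N) (h : N < n) : qbin N n = 0 := by
  rw [qbin, if_neg (by omega)]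
  apply Finset.prod_eq_zero (i := N.toNat)
  · simp; omega
  · have : N - (N.toNat : ℤ) = 0 := by omega
    rw [this]; simp

lemma qbin_mul (N m : ℤ) (hm : 0 ≤ m) (s : ℕ) :
    qbin N m * qbin (N - m) s = qbin N (m + s) * qbin (m + s) s := by
  induction s with
  | zero => simp [qbin_zero]
  | succ s ih =>
    have h1 := qbin_succ (N - m) s (by omega)
    have h2 := qbin_succ N (m + s) (by omega)
    have h3 := qbin_absorb (m + s + 1) s (by omega)
    have n1 := q_pow_ne ((s : ℤ) + 1) (by omega)
    have n2 := q_pow_ne (m + (s : ℤ) + 1) (by omega)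
    rw [add_sub_cancel_right] at h3
    have e : N - m - (s : ℤ) = N - (m + s) := by ring
    rw [e] at h1
    push_cast
    rw [← add_assoc]
    apply mul_right_cancel₀ n1
    linear_combination qbin N m * h1 + (1 - q ^ (N - (m + s))) * ih
      - qbin N (m + s + 1) * h3 - qbin (m + s) s * h2

lemma qbin_mul' (N j : ℤ) (s : ℕ) :
    qbin N (j - s) * qbin (N - j + s) s = qbin N j * qbin j s := by
  rcases lt_or_ge j s with h | h
  · rw [qbin_neg _ (j - s) (by omega)]
    rcases lt_or_ge j 0 with h' | h'
    · rw [qbin_neg _ j h']; simp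
    · rw [qbin_van j s h' h]; simp
  · have := qbin_mul N (j - s) (by omega) s
    rw [sub_add_cancel] at this
    rw [← this]; congr 2; ring

/-- product of two binomials that vanishes -/
lemma qbin_pair (B b x : ℤ) (h0 : 0 ≤ B + b) (h : B < x) : qbin (B + b) b * qbin B x = 0 := by
  rcases lt_or_ge B 0 with h1 | h1
  · rw [qbin_van (B + b) b h0 (by omega)]; simp
  · rw [qbin_van B x h1 h]; simp

/-- shifting a summation index -/
lemma sum_shift (N : ℕ) (f : ℤ → RatFunc ℚ) (h1 : f (-1) = 0) (h2 : f ((N : ℤ) - 1) = 0) :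
    ∑ n ∈ range N, f ((n : ℤ) - 1) = ∑ n ∈ range N, f n := by
  rcases N with _ | N
  · simp
  · rw [Finset.sum_range_succ', Finset.sum_range_succ]
    push_cast at h2 ⊢
    rw [add_sub_cancel_right] at h2
    simp [h1, h2]

/-- the summand of g -/
noncomputable def w (t a b c x y z A B C : ℤ) : RatFunc ℚ :=
  q ^ (T t + T x + T y + T (z - 1)) *
    (q ^ z * qbin (A + a) a * qbin (B + b) b * qbin B x * qbin (C + c) c * qbin C y * qbin C z +
     qbin (A + a - 1) (a - 1) * qbin (B + b) b * qbin B x * qbin (C + c) c * qbin C y *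
       qbin C (z - 1))

lemma w_recB (t a b c x y z A B C : ℤ) :
    w t a b c x y z A B C = w t a b c x y z A (B - 1) C + q ^ (B + t) *
      (w (t - 1) a (b - 1) c x y z A B C + w (t - 1) a b c (x - 1) y z A (B - 1) C) := by
  have h1 := pascal1 (B + b) b
  rw [show B + b - b = B by ring] at h1
  unfold w
  rw [T_step t, T_step x, show B - 1 + b = B + b - 1 by ring,
    show B + (b - 1) = B + b - 1 by ring, h1, pascal1 B x]
  have hq := q_ne
  have hx := zpow_ne_zero x q_ne
  simp only [zpow_add₀ hq, zpow_sub₀ hq]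
  field_simp
  ring

lemma w_recC (t a b c x y z A B C : ℤ) :
    w t a b c x y z A B C = w t a b c x y z A B (C - 1) + q ^ (C + t) *
      (w (t - 1) a b (c - 1) x y z A B C + w (t - 1) a b c x (y - 1) z A B (C - 1) +
        w (t - 1) a b c x y (z - 1) A B (C - 1)) +
      q ^ (2 * (C + t) - 1) * w (t - 2) a b c x (y - 1) (z - 1) A B (C - 1) := by
  have h1 := pascal1 (C + c) c
  rw [show C + c - c = C by ring] at h1
  unfold w
  rw [T_step t, T_step (t - 1), show t - 1 - 1 = t - 2 by ring, T_step y, T_step (z - 1),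
    show C - 1 + c = C + c - 1 by ring, show 2 * (C + t) - 1 = C + C + t + t - 1 by ring,
    show C + (c - 1) = C + c - 1 by ring, h1, pascal1 C y, pascal1 C z, pascal1 C (z - 1)]
  have hq := q_ne
  have hy := zpow_ne_zero y q_ne
  have hz := zpow_ne_zero z q_ne
  have ht := zpow_ne_zero t q_ne
  simp only [zpow_add₀ hq, zpow_sub₀ hq, zpow_one]
  field_simp
  ring

/-- the summand of g with a, b, c eliminated -/
noncomputable def tm (i j k L1 L2 M x y z : ℤ) : RatFunc ℚ :=
  w (i + j + k - x - y - z) (i - x - y) (j - x - z) (k - y - z) x y z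
    (L1 - (i + j + k - x - y - z)) (L2 - (i + j + k - x - y - z)) (M - (i + j + k - x - y - z))

lemma tm_zero (i j k L1 L2 M x y z : ℤ)
    (h : x < 0 ∨ y < 0 ∨ z < 0 ∨ i < x + y ∨ j < x + z ∨ k < y + z) :
    tm i j k L1 L2 M x y z = 0 := by
  unfold tm w
  rcases h with h | h | h | h | h | h
  · rw [qbin_neg _ x h]; ring
  · rw [qbin_neg _ y h]; ring
  · rw [qbin_neg _ z h, qbin_neg _ (z - 1) (by omega)]; ring
  · rw [qbin_neg _ (i - x - y) (by omega), qbin_neg _ (i - x - y - 1) (by omega)]; ring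
  · rw [qbin_neg _ (j - x - z) (by omega)]; ring
  · rw [qbin_neg _ (k - y - z) (by omega)]; ring

lemma tm_recL2 (i j k L1 L2 M x y z : ℤ) :
    tm i j k L1 L2 M x y z = tm i j k L1 (L2 - 1) M x y z + q ^ L2 *
      (tm i (j - 1) k (L1 - 1) (L2 - 1) (M - 1) x y z +
       tm (i - 1) (j - 1) k (L1 - 1) (L2 - 2) (M - 1) (x - 1) y z) := by
  unfold tm
  rw [w_recB]
  congr 1
  · congr 1; ring
  · congr 1
    · congr 1; ring
    · congr 1 <;> congr 1 <;> ring

lemma tm_recM (i j k L1 L2 M x y z : ℤ) :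
    tm i j k L1 L2 M x y z = tm i j k L1 L2 (M - 1) x y z + q ^ M *
      (tm i j (k - 1) (L1 - 1) (L2 - 1) (M - 1) x y z +
       tm (i - 1) j (k - 1) (L1 - 1) (L2 - 1) (M - 2) x (y - 1) z +
       tm i (j - 1) (k - 1) (L1 - 1) (L2 - 1) (M - 2) x y (z - 1)) +
      q ^ (2 * M - 1) * tm (i - 1) (j - 1) (k - 2) (L1 - 2) (L2 - 2) (M - 3) x (y - 1) (z - 1) := by
  unfold tm
  rw [w_recC]
  congr 1
  · congr 1
    · congr 1; ring
    · congr 1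
      · congr 1; ring
      · congr 1
        · congr 1 <;> congr 1 <;> ring
        · congr 1 <;> ring
  · congr 1
    · congr 1; ring
    · congr 1 <;> ring

/-- the box sum -/
noncomputable def G (N : ℕ) (i j k L1 L2 M : ℤ) : RatFunc ℚ :=
  ∑ x ∈ range N, ∑ y ∈ range N, ∑ z ∈ range N, tm i j k L1 L2 M x y z

lemma G_recL2 (N : ℕ) (i j k L1 L2 M : ℤ) (hi : i + 1 < N) :
    G N i j k L1 L2 M = G N i j k L1 (L2 - 1) M + q ^ L2 *
      (G N i (j - 1) k (L1 - 1) (L2 - 1) (M - 1) +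
       G N (i - 1) (j - 1) k (L1 - 1) (L2 - 2) (M - 1)) := by
  have h := sum_shift N (fun x => ∑ y ∈ range N, ∑ z ∈ range N,
    tm (i - 1) (j - 1) k (L1 - 1) (L2 - 2) (M - 1) x y z)
    (Finset.sum_eq_zero fun y _ => Finset.sum_eq_zero fun z _ => tm_zero _ _ _ _ _ _ _ _ _ (by omega))
    (Finset.sum_eq_zero fun y _ => Finset.sum_eq_zero fun z _ => tm_zero _ _ _ _ _ _ _ _ _ (by omega))
  unfold G
  rw [← h]
  simp only [Finset.mul_sum, ← Finset.sum_add_distrib]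
  refine Finset.sum_congr rfl fun x _ => Finset.sum_congr rfl fun y _ =>
    Finset.sum_congr rfl fun z _ => ?_
  exact tm_recL2 i j k L1 L2 M x y z

lemma G_recM (N : ℕ) (i j k L1 L2 M : ℤ) (hi : i + 1 < N) (hj : j + 1 < N) :
    G N i j k L1 L2 M = G N i j k L1 L2 (M - 1) + q ^ M *
      (G N i j (k - 1) (L1 - 1) (L2 - 1) (M - 1) +
       G N (i - 1) j (k - 1) (L1 - 1) (L2 - 1) (M - 2) +
       G N i (j - 1) (k - 1) (L1 - 1) (L2 - 1) (M - 2)) +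
      q ^ (2 * M - 1) * G N (i - 1) (j - 1) (k - 2) (L1 - 2) (L2 - 2) (M - 3) := by
  have h1 : ∀ (i j k L1 L2 M : ℤ) (x z : ℤ), 0 ≤ x → i + 1 < N →
      ∑ y ∈ range N, tm i j k L1 L2 M x ((y : ℤ) - 1) z = ∑ y ∈ range N, tm i j k L1 L2 M x y z := by
    intro i j k L1 L2 M x z hx hi
    exact sum_shift N (fun y => tm i j k L1 L2 M x y z)
      (tm_zero _ _ _ _ _ _ _ _ _ (by omega)) (tm_zero _ _ _ _ _ _ _ _ _ (by omega))
  have h2 : ∀ (i j k L1 L2 M : ℤ) (x y : ℤ), 0 ≤ x → j + 1 < N →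
      ∑ z ∈ range N, tm i j k L1 L2 M x y ((z : ℤ) - 1) = ∑ z ∈ range N, tm i j k L1 L2 M x y z := by
    intro i j k L1 L2 M x y hx hi
    exact sum_shift N (fun z => tm i j k L1 L2 M x y z)
      (tm_zero _ _ _ _ _ _ _ _ _ (by omega)) (tm_zero _ _ _ _ _ _ _ _ _ (by omega))
  have e1 : G N (i - 1) j (k - 1) (L1 - 1) (L2 - 1) (M - 2) = ∑ x ∈ range N, ∑ y ∈ range N,
      ∑ z ∈ range N, tm (i - 1) j (k - 1) (L1 - 1) (L2 - 1) (M - 2) x ((y : ℤ) - 1) z := by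
    unfold G
    refine Finset.sum_congr rfl fun x _ => ?_
    rw [Finset.sum_comm]
    conv_rhs => rw [Finset.sum_comm]
    refine Finset.sum_congr rfl fun z _ => ?_
    rw [h1 _ _ _ _ _ _ _ _ (by omega) (by omega)]
  have e2 : G N i (j - 1) (k - 1) (L1 - 1) (L2 - 1) (M - 2) = ∑ x ∈ range N, ∑ y ∈ range N,
      ∑ z ∈ range N, tm i (j - 1) (k - 1) (L1 - 1) (L2 - 1) (M - 2) x y ((z : ℤ) - 1) := by
    unfold G
    refine Finset.sum_congr rfl fun x _ => Finset.sum_congr rfl fun y _ => ?_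
    rw [h2 _ _ _ _ _ _ _ _ (by omega) (by omega)]
  have e3 : G N (i - 1) (j - 1) (k - 2) (L1 - 2) (L2 - 2) (M - 3) = ∑ x ∈ range N, ∑ y ∈ range N,
      ∑ z ∈ range N, tm (i - 1) (j - 1) (k - 2) (L1 - 2) (L2 - 2) (M - 3) x ((y : ℤ) - 1)
        ((z : ℤ) - 1) := by
    unfold G
    refine Finset.sum_congr rfl fun x _ => ?_
    rw [Finset.sum_comm]
    conv_rhs =>
      enter [2, y]
      rw [h2 _ _ _ _ _ _ _ _ (by omega) (by omega)]
    conv_rhs => rw [Finset.sum_comm]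
    refine Finset.sum_congr rfl fun z _ => ?_
    rw [h1 _ _ _ _ _ _ _ _ (by omega) (by omega)]
  rw [e1, e2, e3]
  unfold G
  simp only [Finset.mul_sum, ← Finset.sum_add_distrib]
  refine Finset.sum_congr rfl fun x _ => Finset.sum_congr rfl fun y _ =>
    Finset.sum_congr rfl fun z _ => ?_
  exact tm_recM i j k L1 L2 M x y z

/-- the summand of p without the factor depending on L2 -/
noncomputable def pt (i j k L1 M s : ℤ) : RatFunc ℚ :=
  q ^ (s * (M + 2) - T s + T (i - s) + T (j - s) + T (k - s)) *
    qbin (L1 - s) (i - s) * qbin j s * qbin (M - i - j) (k - s)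

lemma pt_rec (i j k L1 M s : ℤ) :
    pt i j k L1 M s = q ^ j * pt i (j - 1) k L1 (M - 1) s +
      q ^ (M + j) * pt (i - 1) (j - 1) (k - 1) (L1 - 1) (M - 2) (s - 1) := by
  unfold pt
  rw [pascal1 j s]
  have a1 : M - 1 - i - (j - 1) = M - i - j := by ring
  have a2 : M - 2 - (i - 1) - (j - 1) = M - i - j := by ring
  have a3 : L1 - 1 - (s - 1) = L1 - s := by ring
  have a4 : i - 1 - (s - 1) = i - s := by ring
  have a5 : j - 1 - (s - 1) = j - s := by ring
  have a6 : k - 1 - (s - 1) = k - s := by ring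
  have a7 : j - 1 - s = j - s - 1 := by ring
  rw [a1, a2, a3, a4, a5, a6, a7]
  have e1 : s * (M + 2) - T s + T (i - s) + T (j - s) + T (k - s) =
      j + (s * (M - 1 + 2) - T s + T (i - s) + T (j - s - 1) + T (k - s)) := by
    rw [T_step (j - s)]; ring
  have e2 : s * (M + 2) - T s + T (i - s) + T (j - s) + T (k - s) + (j - s) =
      (M + j) + ((s - 1) * (M - 2 + 2) - T (s - 1) + T (i - s) + T (j - s) + T (k - s)) := by
    rw [T_step s]; ring
  have f1 := congrArg (fun e => q ^ e) e1
  have f2 := congrArg (fun e => q ^ e) e2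
  rw [zpow_add₀ q_ne j] at f1
  rw [zpow_add₀ q_ne _ (j - s), zpow_add₀ q_ne (M + j)] at f2
  linear_combination
    qbin (L1 - s) (i - s) * qbin (j - 1) s * qbin (M - i - j) (k - s) * f1 +
    qbin (L1 - s) (i - s) * qbin (j - 1) (s - 1) * qbin (M - i - j) (k - s) * f2

noncomputable def P (N : ℕ) (i j k L1 M : ℤ) : RatFunc ℚ := ∑ s ∈ range N, pt i j k L1 M s

lemma P_rec (N : ℕ) (i j k L1 M : ℤ) (hi : i < N) :
    P N i j k L1 M = q ^ j * P N i (j - 1) k L1 (M - 1) +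
      q ^ (M + j) * P N (i - 1) (j - 1) (k - 1) (L1 - 1) (M - 2) := by
  have h := sum_shift N (fun s => pt (i - 1) (j - 1) (k - 1) (L1 - 1) (M - 2) s)
    (by simp only [pt]; rw [qbin_neg (j - 1) (-1) (by omega)]; ring)
    (by simp only [pt]; rw [qbin_neg _ (i - 1 - ((N : ℤ) - 1)) (by omega)]; ring)
  unfold P
  rw [← h]
  simp only [Finset.mul_sum, ← Finset.sum_add_distrib]
  exact Finset.sum_congr rfl fun s _ => pt_rec i j k L1 M s

lemma P_zero (N : ℕ) (hN : 0 < N) (i k L1 M : ℤ) :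
    P N i 0 k L1 M = q ^ (T i + T k) * qbin L1 i * qbin (M - i) k := by
  unfold P
  rw [Finset.sum_eq_single_of_mem 0 (by simpa using hN)]
  · have : T 0 = 0 := by decide
    simp [pt, qbin_zero, this]
  · intro s _ hs
    unfold pt
    rw [qbin_van 0 s le_rfl (by omega)]; ring

lemma P_recL2 (N : ℕ) (hN : 0 < N) (j : ℕ) : ∀ (i k L1 M : ℤ), i < N →
    P N i (j + 1) k L1 M = q ^ (i + j + 1) *
      (P N i j k (L1 - 1) (M - 1) + P N (i - 1) j k (L1 - 1) (M - 1)) := by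
  induction j with
  | zero =>
    intro i k L1 M hi
    rw [P_rec N _ _ _ _ _ hi]
    simp only [Nat.cast_zero, zero_add, add_zero, sub_self]
    rw [P_zero N hN, P_zero N hN, P_zero N hN, P_zero N hN, pascal2 L1 i]
    have a1 : M - 1 - (i - 1) = M - i := by ring
    have a2 : M - 2 - (i - 1) = M - 1 - i := by ring
    have a3 : M - i - 1 = M - 1 - i := by ring
    rw [a1, a2, pascal1 (M - i) k, a3, T_step i, T_step k]
    have hq := q_ne
    have hi' := zpow_ne_zero i q_ne
    have hk' := zpow_ne_zero k q_ne
    simp only [zpow_add₀ hq, zpow_sub₀ hq, zpow_one]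
    field_simp
    ring
  | succ j ih =>
    intro i k L1 M hi
    rw [P_rec N _ _ _ _ _ hi]
    push_cast
    rw [add_sub_cancel_right, ih i k L1 (M - 1) hi, ih (i - 1) (k - 1) (L1 - 1) (M - 2) (by omega),
      P_rec N i ((j : ℤ) + 1) k (L1 - 1) (M - 1) hi,
      P_rec N (i - 1) ((j : ℤ) + 1) k (L1 - 1) (M - 1) (by omega), add_sub_cancel_right]
    have a1 : M - 1 - 2 = M - 2 - 1 := by ring
    rw [a1]
    have hq := q_ne
    simp only [zpow_add₀ hq, zpow_sub₀ hq, zpow_one]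
    field_simp
    ring

lemma P_recM (N : ℕ) (hN : 0 < N) (j : ℕ) : ∀ (i k L1 M : ℤ), i < N →
    P N i j k L1 M = P N i j k L1 (M - 1) + q ^ M *
      (q ^ (-(j : ℤ)) * P N i j (k - 1) (L1 - 1) (M - 1) +
        P N (i - 1) j (k - 1) (L1 - 1) (M - 2)) := by
  induction j with
  | zero =>
    intro i k L1 M hi
    simp only [Nat.cast_zero]
    rw [P_zero N hN, P_zero N hN, P_zero N hN, P_zero N hN, pascal2 L1 i]
    have a2 : M - 2 - (i - 1) = M - 1 - i := by ring
    have a3 : M - i - 1 = M - 1 - i := by ring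
    rw [a2, pascal1 (M - i) k, a3, T_step i, T_step k]
    have hq := q_ne
    have hi' := zpow_ne_zero i q_ne
    have hk' := zpow_ne_zero k q_ne
    simp only [neg_zero, zpow_zero, zpow_add₀ hq, zpow_sub₀ hq]
    field_simp
  | succ j ih =>
    intro i k L1 M hi
    have h1 := P_rec N i ((j : ℤ) + 1) k L1 M hi
    have h2 := P_rec N i ((j : ℤ) + 1) k L1 (M - 1) hi
    have h3 := P_rec N i ((j : ℤ) + 1) (k - 1) (L1 - 1) (M - 1) hi
    have h4 := P_rec N (i - 1) ((j : ℤ) + 1) (k - 1) (L1 - 1) (M - 2) (by omega)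
    have h5 := ih i k L1 (M - 1) hi
    have h6 := ih (i - 1) (k - 1) (L1 - 1) (M - 2) (by omega)
    push_cast
    rw [add_sub_cancel_right] at h1 h2 h3 h4
    rw [show M - 1 - 1 = M - 2 by ring, show M - 1 - 2 = M - 3 by ring] at *
    rw [show M - 2 - 1 = M - 3 by ring, show M - 2 - 2 = M - 4 by ring] at *
    rw [h1, h2, h3, h4, h5, h6]
    have hq := q_ne
    have hj' := zpow_ne_zero (j : ℤ) q_ne
    have hM' := zpow_ne_zero M q_ne
    simp only [zpow_neg, zpow_add₀ hq, zpow_sub₀ hq, zpow_one]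
    field_simp
    ring

/-- p in factored form -/
noncomputable def pp (N : ℕ) (i j k L1 L2 M : ℤ) : RatFunc ℚ := qbin (L2 - i) j * P N i j k L1 M

lemma pp_recL2 (N : ℕ) (i j k L1 L2 M : ℤ) (hN : 0 < N) (hi : i < N) (hj : 1 ≤ j) :
    pp N i j k L1 L2 M = pp N i j k L1 (L2 - 1) M + q ^ L2 *
      (pp N i (j - 1) k (L1 - 1) (L2 - 1) (M - 1) +
       pp N (i - 1) (j - 1) k (L1 - 1) (L2 - 2) (M - 1)) := by
  obtain ⟨m, rfl⟩ : ∃ m : ℕ, j = (m : ℤ) + 1 := ⟨(j - 1).toNat, by omega⟩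
  have h := P_recL2 N hN m i k L1 M hi
  unfold pp
  rw [add_sub_cancel_right, show L2 - 2 - (i - 1) = L2 - i - 1 by ring,
    show L2 - 1 - i = L2 - i - 1 by ring, pascal1 (L2 - i), add_sub_cancel_right, add_mul,
    mul_comm (q ^ (L2 - i - ((m : ℤ) + 1))), mul_assoc]
  congr 1
  have e : q ^ (L2 - i - ((m : ℤ) + 1)) * q ^ (i + m + 1) = q ^ L2 := by
    rw [← zpow_add₀ q_ne]; congr 1; ring
  rw [h, ← e]
  ring

lemma pp_recM (N : ℕ) (i j k L1 L2 M : ℤ) (hN : 0 < N) (hi : i < N) (hj : 0 ≤ j) :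
    pp N i j k L1 L2 M = pp N i j k L1 L2 (M - 1) + q ^ M *
      (pp N i j (k - 1) (L1 - 1) (L2 - 1) (M - 1) +
       pp N (i - 1) j (k - 1) (L1 - 1) (L2 - 1) (M - 2) +
       pp N i (j - 1) (k - 1) (L1 - 1) (L2 - 1) (M - 2)) +
      q ^ (2 * M - 1) * pp N (i - 1) (j - 1) (k - 2) (L1 - 2) (L2 - 2) (M - 3) := by
  obtain ⟨m, rfl⟩ := Int.eq_ofNat_of_zero_le hj
  have h := P_recM N hN m i k L1 M hi
  have h0 := P_rec N i m (k - 1) (L1 - 1) (M - 1) hi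
  have h1 := pascal2 (L2 - i) m
  unfold pp
  rw [show L2 - 2 - (i - 1) = L2 - i - 1 by ring, show L2 - 1 - i = L2 - i - 1 by ring,
    show L2 - 1 - (i - 1) = L2 - i by ring, show (2 * M - 1) = M + M - 1 by ring]
  rw [show k - 1 - 1 = k - 2 by ring, show L1 - 1 - 1 = L1 - 2 by ring,
    show M - 1 - 1 = M - 2 by ring, show M - 1 - 2 = M - 3 by ring] at h0
  have hq := q_ne
  have hm := zpow_ne_zero (m : ℤ) q_ne
  rw [h]
  simp only [zpow_neg, zpow_add₀ hq, zpow_sub₀ hq, zpow_one] at h0 h1 ⊢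
  generalize qbin (L2 - i) m = Q0 at *
  generalize qbin (L2 - i - 1) m = Q1 at *
  generalize qbin (L2 - i - 1) ((m : ℤ) - 1) = Q2 at *
  rw [h1, h0]
  field_simp
  ring

lemma int_const (f : ℤ → Prop) (h : ∀ m, f m ↔ f (m - 1)) (a b : ℤ) (ha : f a) : f b := by
  have key : ∀ m, f m ↔ f 0 := by
    intro m
    induction m using Int.induction_on with
    | zero => rfl
    | succ n ih => rw [h, add_sub_cancel_right, ih]
    | pred n ih => rw [← h, ih]
  exact (key b).2 ((key a).1 ha)

lemma w_zero_B (t a b c x y z A B C : ℤ) (h : qbin (B + b) b * qbin B x = 0) :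
    w t a b c x y z A B C = 0 := by
  unfold w
  rcases mul_eq_zero.mp h with h | h <;> rw [h] <;> ring

lemma w_zero_C (t a b c x y z A B C : ℤ) (h : qbin (C + c) c * qbin C y = 0) :
    w t a b c x y z A B C = 0 := by
  unfold w
  rcases mul_eq_zero.mp h with h | h <;> rw [h] <;> ring

lemma tm_zero_B (i j k L1 M x y z : ℤ) (h : 0 ≤ j - 1 - k + y) :
    tm i j k L1 (i + j - 1) M x y z = 0 := by
  by_cases hc : k < y + z
  · exact tm_zero _ _ _ _ _ _ _ _ _ (by omega)
  exact w_zero_B _ _ _ _ _ _ _ _ _ _ (qbin_pair _ _ _ (by omega) (by omega))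

lemma tm_zero_C (i j k L1 L2 x y z : ℤ) (h : 0 ≤ k - 1 - j + x) :
    tm i j k L1 L2 (i + k - 1) x y z = 0 := by
  by_cases hc : j < x + z
  · exact tm_zero _ _ _ _ _ _ _ _ _ (by omega)
  exact w_zero_C _ _ _ _ _ _ _ _ _ _ (qbin_pair _ _ _ (by omega) (by omega))

lemma G_j_gt (N : ℕ) (i j k L1 M : ℤ) (h : k < j) : G N i j k L1 (i + j - 1) M = 0 :=
  Finset.sum_eq_zero fun x _ => Finset.sum_eq_zero fun y _ => Finset.sum_eq_zero fun z _ =>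
    tm_zero_B _ _ _ _ _ _ _ _ (by omega)

lemma G_k_gt (N : ℕ) (i j k L1 L2 : ℤ) (h : j < k) : G N i j k L1 L2 (i + k - 1) = 0 :=
  Finset.sum_eq_zero fun x _ => Finset.sum_eq_zero fun y _ => Finset.sum_eq_zero fun z _ =>
    tm_zero_C _ _ _ _ _ _ _ _ (by omega)

/-- telescoping certificate for the diagonal case -/
noncomputable def hh (i j L1 z : ℤ) : RatFunc ℚ :=
  q ^ (T (i + 2 * j - z) + T (z - 1)) * qbin (-1) (j - z) ^ 2 * qbin (z - j) z *
    qbin (L1 - 2 * j + z) i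

lemma qbin_neg_one (b : ℤ) (hb : 0 ≤ b) : qbin (-1) (b + 1) = - q ^ (-(b + 1)) * qbin (-1) b := by
  have h := qbin_succ (-1) b hb
  have hne := q_pow_ne (b + 1) (by omega)
  apply mul_right_cancel₀ hne
  rw [h, show -1 - b = -(b + 1) by ring]
  have : q ^ (-(b + 1)) * q ^ (b + 1) = 1 := by rw [← zpow_add₀ q_ne]; simp
  linear_combination (-qbin (-1) b) * this

lemma hh_tel (i j L1 z : ℤ) (hj : 1 ≤ j) :
    tm i j j L1 (i + j - 1) (i + j - 1) 0 0 z = hh i j L1 z - hh i j L1 (z - 1) := by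
  rcases lt_or_ge j z with h | h
  · rw [tm_zero _ _ _ _ _ _ _ _ _ (by omega)]
    unfold hh
    rw [qbin_neg _ (j - z) (by omega)]
    rcases lt_or_ge (j + 1) z with h' | h'
    · rw [qbin_neg _ (j - (z - 1)) (by omega)]; ring
    · rw [qbin_van (z - 1 - j) (z - 1) (by omega) (by omega)]; ring
  · have e1 := qbin_neg_one (j - z) (by omega)
    have hT : T 0 = 0 := by decide
    unfold tm w hh
    simp only [sub_zero, qbin_zero, hT, add_zero]
    rw [show i + j - 1 - (i + j + j - z) + (j - z) = -1 by ring,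
      show i + j - 1 - (i + j + j - z) = z - j - 1 by ring,
      show L1 - (i + j + j - z) + i = L1 - 2 * j + z by ring,
      show i + j + j - z = i + 2 * j - z by ring,
      show i + 2 * j - (z - 1) = i + 2 * j - z + 1 by ring,
      show j - (z - 1) = j - z + 1 by ring, e1,
      show z - 1 - j = z - j - 1 by ring,
      show L1 - 2 * j + (z - 1) = L1 - 2 * j + z - 1 by ring,
      pascal2 (L1 - 2 * j + z) i, pascal2 (z - j) z, T_step (i + 2 * j - z + 1), T_step (z - 1),
      add_sub_cancel_right]
    have hq := q_ne
    have hz := zpow_ne_zero z q_ne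
    have hj := zpow_ne_zero j q_ne
    simp only [neg_add, neg_sub, two_mul, zpow_neg, zpow_add₀ hq, zpow_sub₀ hq, zpow_one]
    field_simp
    ring

lemma G_diag (N : ℕ) (i j L1 : ℤ) (hj : 1 ≤ j) (hN : j + 1 < N) :
    G N i j j L1 (i + j - 1) (i + j - 1) = 0 := by
  unfold G
  have h0 : 0 ∈ range N := by simp; omega
  rw [Finset.sum_eq_single_of_mem 0 h0, Finset.sum_eq_single_of_mem 0 h0]
  · have h1 : ∑ z ∈ range N, hh i j L1 ((z : ℤ) - 1) = ∑ z ∈ range N, hh i j L1 z :=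
      sum_shift N (hh i j L1)
        (by unfold hh; rw [qbin_neg _ (-1) (by omega)]; ring)
        (by unfold hh; rw [qbin_neg _ (j - ((N : ℤ) - 1)) (by omega)]; ring)
    simp only [Nat.cast_zero, hh_tel i j L1 _ hj]
    rw [Finset.sum_sub_distrib, h1, sub_self]
  · intro y _ hy
    exact Finset.sum_eq_zero fun z _ => tm_zero_B _ _ _ _ _ _ _ _ (by omega)
  · intro x _ hx
    exact Finset.sum_eq_zero fun y _ => Finset.sum_eq_zero fun z _ =>
      tm_zero_C _ _ _ _ _ _ _ _ (by omega)

lemma pp_L2 (N : ℕ) (i j k L1 M : ℤ) (hj : 1 ≤ j) : pp N i j k L1 (i + j - 1) M = 0 := by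
  unfold pp
  rw [qbin_van _ j (by omega) (by omega)]; ring

lemma pp_M (N : ℕ) (i j k L1 L2 : ℤ) (hj : 0 ≤ j) (hk : j < k) :
    pp N i j k L1 L2 (i + k - 1) = 0 := by
  unfold pp P
  rw [Finset.sum_eq_zero, mul_zero]
  intro s _
  unfold pt
  rcases lt_or_ge j s with h | h
  · rw [qbin_van j s hj h]; ring
  · rw [qbin_van _ (k - s) (by omega) (by omega)]; ring

lemma triv_case (N : ℕ) (i j k L1 L2 M : ℤ) (h : j < 0 ∨ k < 0) :
    G N i j k L1 L2 M = pp N i j k L1 L2 M := by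
  have h1 : G N i j k L1 L2 M = 0 :=
    Finset.sum_eq_zero fun x _ => Finset.sum_eq_zero fun y _ => Finset.sum_eq_zero fun z _ =>
      tm_zero _ _ _ _ _ _ _ _ _ (by omega)
  rw [h1]
  unfold pp
  rcases h with h | h
  · rw [qbin_neg _ _ h]; ring
  · unfold P
    rw [Finset.sum_eq_zero, mul_zero]
    intro s _
    unfold pt
    rw [qbin_neg _ (k - s) (by omega)]; ring

lemma zero_case (N : ℕ) (hN : 0 < N) (i L1 L2 M : ℤ) :
    G N i 0 0 L1 L2 M = pp N i 0 0 L1 L2 M := by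
  unfold pp
  rw [P_zero N hN, qbin_zero, qbin_zero]
  unfold G
  have h0 : 0 ∈ range N := by simpa using hN
  have hT : T 0 = 0 := by decide
  have hT1 : T (-1) = 0 := by decide
  rw [Finset.sum_eq_single_of_mem 0 h0, Finset.sum_eq_single_of_mem 0 h0,
    Finset.sum_eq_single_of_mem 0 h0]
  · unfold tm w
    simp [qbin_zero, hT, hT1, qbin_neg _ (-1) (by omega)]
  · intro z _ hz
    exact tm_zero _ _ _ _ _ _ _ _ _ (by omega)
  · intro y _ hy
    exact Finset.sum_eq_zero fun z _ => tm_zero _ _ _ _ _ _ _ _ _ (by omega)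
  · intro x _ hx
    exact Finset.sum_eq_zero fun y _ => Finset.sum_eq_zero fun z _ =>
      tm_zero _ _ _ _ _ _ _ _ _ (by omega)

lemma main_id (N : ℕ) (hN : 0 < N) (n : ℕ) : ∀ i j k L1 L2 M : ℤ, i + 1 < N → j + 1 < N →
    j + k < n → G N i j k L1 L2 M = pp N i j k L1 L2 M := by
  induction n with
  | zero =>
    intro i j k L1 L2 M _ _ h
    exact triv_case _ _ _ _ _ _ _ (by push_cast at h; omega)
  | succ n ih =>
    intro i j k L1 L2 M hi hj h
    push_cast at h
    by_cases hjk : j < 0 ∨ k < 0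
    · exact triv_case _ _ _ _ _ _ _ hjk
    have stepL2 : 1 ≤ j → ∀ L1 M L2 : ℤ, G N i j k L1 L2 M = pp N i j k L1 L2 M ↔
        G N i j k L1 (L2 - 1) M = pp N i j k L1 (L2 - 1) M := by
      intro hj1 L1 M L2
      rw [G_recL2 N i j k L1 L2 M hi, pp_recL2 N i j k L1 L2 M hN (by omega) hj1,
        ih i (j - 1) k _ _ _ hi (by omega) (by omega),
        ih (i - 1) (j - 1) k _ _ _ (by omega) (by omega) (by omega)]
      constructor <;> intro h <;> linear_combination h
    have stepM : ∀ L1 L2 M : ℤ, G N i j k L1 L2 M = pp N i j k L1 L2 M ↔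
        G N i j k L1 L2 (M - 1) = pp N i j k L1 L2 (M - 1) := by
      intro L1 L2 M
      rw [G_recM N i j k L1 L2 M hi hj, pp_recM N i j k L1 L2 M hN (by omega) (by omega),
        ih i j (k - 1) _ _ _ hi hj (by omega),
        ih (i - 1) j (k - 1) _ _ _ (by omega) hj (by omega),
        ih i (j - 1) (k - 1) _ _ _ hi (by omega) (by omega),
        ih (i - 1) (j - 1) (k - 2) _ _ _ (by omega) (by omega) (by omega)]
      constructor <;> intro h <;> linear_combination h
    rcases lt_trichotomy j k with hlt | heq | hgt
    · refine int_const (fun M => G N i j k L1 L2 M = pp N i j k L1 L2 M) (stepM L1 L2)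
        (i + k - 1) M ?_
      rw [G_k_gt N i j k L1 L2 hlt, pp_M N i j k L1 L2 (by omega) hlt]
    · subst heq
      by_cases hj0 : j = 0
      · subst hj0; exact zero_case N hN i L1 L2 M
      · refine int_const (fun M => G N i j j L1 L2 M = pp N i j j L1 L2 M) (stepM L1 L2)
          (i + j - 1) M ?_
        refine int_const (fun L2 => G N i j j L1 L2 (i + j - 1) = pp N i j j L1 L2 (i + j - 1))
          (stepL2 (by omega) L1 (i + j - 1)) (i + j - 1) L2 ?_
        rw [G_diag N i j L1 (by omega) hj, pp_L2 N i j j L1 _ (by omega)]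
    · refine int_const (fun L2 => G N i j k L1 L2 M = pp N i j k L1 L2 M)
        (stepL2 (by omega) L1 M) (i + j - 1) L2 ?_
      rw [G_j_gt N i j k L1 M hgt, pp_L2 N i j k L1 M (by omega)]

/-- enlarging the summation range -/
lemma sum_ext_range (m N : ℕ) (h : m ≤ N) (f : ℕ → RatFunc ℚ) (hf : ∀ n, m ≤ n → f n = 0) :
    ∑ n ∈ range m, f n = ∑ n ∈ range N, f n := by
  apply Finset.sum_subset (Finset.range_mono h)
  intro n _ hn
  exact hf n (by simpa using hn)

lemma g_eq_G (N : ℕ) (i j k L1 L2 M : ℤ) (hi : i + 1 < N) (hj : j + 1 < N) (hN : 1 < N) :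
    g i j k L1 L2 M = G N i j k L1 L2 M := by
  have key : g i j k L1 L2 M = ∑ x ∈ range (i.toNat + 1), ∑ y ∈ range (i.toNat + 1),
      ∑ z ∈ range (j.toNat + 1), tm i j k L1 L2 M x y z := by
    unfold g
    refine Finset.sum_congr rfl fun x _ => Finset.sum_congr rfl fun y _ =>
      Finset.sum_congr rfl fun z _ => ?_
    split_ifs with hc
    · have et : i - (x : ℤ) - y + (j - x - z) + (k - y - z) + x + y + z = i + j + k - x - y - z := by
        ring
      simp only [et]
      rfl
    · exact (tm_zero _ _ _ _ _ _ _ _ _ (by omega)).symm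
  rw [key]
  unfold G
  rw [sum_ext_range (i.toNat + 1) N (by omega)]
  · refine Finset.sum_congr rfl fun x _ => ?_
    rw [sum_ext_range (i.toNat + 1) N (by omega)]
    · refine Finset.sum_congr rfl fun y _ => ?_
      rw [sum_ext_range (j.toNat + 1) N (by omega)]
      intro z hz
      exact tm_zero _ _ _ _ _ _ _ _ _ (by omega)
    · intro y hy
      exact Finset.sum_eq_zero fun z _ => tm_zero _ _ _ _ _ _ _ _ _ (by omega)
  · intro x hx
    exact Finset.sum_eq_zero fun y _ => Finset.sum_eq_zero fun z _ =>
      tm_zero _ _ _ _ _ _ _ _ _ (by omega)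

lemma p_eq_pp (N : ℕ) (i j k L1 L2 M : ℤ) (hi : i + 1 < N) (hN : 1 < N) :
    p i j k L1 L2 M = pp N i j k L1 L2 M := by
  unfold p pp P
  rw [Finset.mul_sum, ← sum_ext_range (i.toNat + 1) N (by omega)]
  · refine Finset.sum_congr rfl fun s _ => ?_
    have := qbin_mul' (L2 - i) j s
    unfold pt
    linear_combination (q ^ ((s : ℤ) * (M + 2) - T s + T (i - s) + T (j - s) + T (k - s)) *
      qbin (L1 - s) (i - s) * qbin (M - i - j) (k - s)) * this
  · intro s hs
    unfold pt
    rw [qbin_neg _ (i - s) (by omega)]; ring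

theorem triple_bounded_identity (i j k L1 L2 M : ℤ) :
    g i j k L1 L2 M = p i j k L1 L2 M := by
  have hN : 1 < i.toNat + j.toNat + 2 := by omega
  rw [g_eq_G (i.toNat + j.toNat + 2) i j k L1 L2 M (by push_cast; omega) (by push_cast; omega) hN,
    p_eq_pp (i.toNat + j.toNat + 2) i j k L1 L2 M (by push_cast; omega) hN]
  exact main_id _ (by omega) ((j + k).toNat + 1) i j k L1 L2 M (by push_cast; omega)
    (by push_cast; omega) (by push_cast; omega)
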